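/- arXiv:1402.4944 — 2 statements merged into one kernel-verified Lean document; each statement's English description precedes it below -/
import Mathlib

section
/- Let X = MD(G, S0, S1, T0, T1) be a strongly connected mixed Cayley digraph. Suppose there exist a proper subgroup H of G with |H| < δ(X), an element s1 ∈ S1 with ⟨(S1 ∪ {1_G}) \ {s1}⟩ ≤ H, and an element t1 ∈ T1 with ⟨S0⟩ ≤ t1⁻¹·H·t1, T0·t1⁻¹ ⊆ H, and t1·T1⁻¹ ⊆ H. Then λ(X) < δ(X). -/
open Set Pointwise

/-- Arc relation of the mixed Cayley digraph `MD(G,S0,S1,T0,T1)` on vertex set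
`G × Bool`, where `false` plays the role of the index `0` and `true` of `1`. -/
def MDArc {G : Type*} [Group G] (S0 S1 T0 T1 : Set G) (u v : G × Bool) : Prop :=
  (u.2 = false ∧ v.2 = false ∧ ∃ s ∈ S0, v.1 = s * u.1) ∨
  (u.2 = true ∧ v.2 = true ∧ ∃ s ∈ S1, v.1 = s * u.1) ∨
  (u.2 = false ∧ v.2 = true ∧ ∃ t ∈ T0, v.1 = t * u.1) ∨
  (u.2 = true ∧ v.2 = false ∧ ∃ t ∈ T1, u.1 = t * v.1)

/-- A digraph (given by its arc relation) is strongly connected if every vertex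
is reachable from every other vertex by a directed path. -/
def DigraphStronglyConnected {V : Type*} (R : V → V → Prop) : Prop :=
  ∀ u v : V, Relation.ReflTransGen R u v

/-- Out-degree of a vertex: the number of arcs originating at it. -/
noncomputable def outDegree {V : Type*} (R : V → V → Prop) (v : V) : ℕ :=
  {w | R v w}.ncard

/-- In-degree of a vertex: the number of arcs terminating at it. -/
noncomputable def inDegree {V : Type*} (R : V → V → Prop) (v : V) : ℕ :=
  {w | R w v}.ncard

/-- `δ`: the minimum, over all vertices, of in-degrees and out-degrees. -/
noncomputable def minDegree {V : Type*} (R : V → V → Prop) : ℕ :=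
  sInf {n | ∃ v, n = outDegree R v ∨ n = inDegree R v}

/-- `W` is an arc-disconnecting set: a set of arcs whose deletion leaves a
digraph that is not strongly connected. -/
def IsDisconnectingArcSet {V : Type*} (R : V → V → Prop) (W : Set (V × V)) : Prop :=
  (∀ p ∈ W, R p.1 p.2) ∧
  ¬ DigraphStronglyConnected (fun u v => R u v ∧ (u, v) ∉ W)

/-- The arc connectivity `λ`: the minimum cardinality of an arc-disconnecting set. -/
noncomputable def arcConnectivity {V : Type*} (R : V → V → Prop) : ℕ :=
  sInf {n | ∃ W : Set (V × V), IsDisconnectingArcSet R W ∧ W.ncard = n}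

/-- `ω⁺(A)`: the set of arcs from `A` to its complement. -/
def omegaPlus {V : Type*} (R : V → V → Prop) (A : Set V) : Set (V × V) :=
  {p | R p.1 p.2 ∧ p.1 ∈ A ∧ p.2 ∉ A}

/-- `ω⁻(A)`: the set of arcs from the complement of `A` to `A`. -/
def omegaMinus {V : Type*} (R : V → V → Prop) (A : Set V) : Set (V × V) :=
  {p | R p.1 p.2 ∧ p.1 ∉ A ∧ p.2 ∈ A}

/-- A positive arc fragment: a proper nonempty vertex subset with `|ω⁺(A)| = λ`. -/
def IsPosFragment {V : Type*} (R : V → V → Prop) (A : Set V) : Prop :=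
  A.Nonempty ∧ A ≠ Set.univ ∧ (omegaPlus R A).ncard = arcConnectivity R

/-- A negative arc fragment: a proper nonempty vertex subset with `|ω⁻(A)| = λ`. -/
def IsNegFragment {V : Type*} (R : V → V → Prop) (A : Set V) : Prop :=
  A.Nonempty ∧ A ≠ Set.univ ∧ (omegaMinus R A).ncard = arcConnectivity R

/-- An arc fragment: a positive or negative arc fragment. -/
def IsArcFragment {V : Type*} (R : V → V → Prop) (A : Set V) : Prop :=
  IsPosFragment R A ∨ IsNegFragment R A

/-- A `λ`-atom: an arc fragment of least possible cardinality. -/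
def IsLambdaAtom {V : Type*} (R : V → V → Prop) (A : Set V) : Prop :=
  IsArcFragment R A ∧ ∀ B, IsArcFragment R B → A.ncard ≤ B.ncard

/-- A positive `λ`-atom: a positive arc fragment of least possible cardinality
among all arc fragments. -/
def IsPosLambdaAtom {V : Type*} (R : V → V → Prop) (A : Set V) : Prop :=
  IsPosFragment R A ∧ ∀ B, IsArcFragment R B → A.ncard ≤ B.ncard

/-- A negative `λ`-atom: a negative arc fragment of least possible cardinality
among all arc fragments. -/
def IsNegLambdaAtom {V : Type*} (R : V → V → Prop) (A : Set V) : Prop :=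
  IsNegFragment R A ∧ ∀ B, IsArcFragment R B → A.ncard ≤ B.ncard

/-- A `λ`-superatom: an arc fragment with at least two vertices, of least
possible cardinality among arc fragments with at least two vertices. -/
def IsLambdaSuperatom {V : Type*} (R : V → V → Prop) (A : Set V) : Prop :=
  IsArcFragment R A ∧ 2 ≤ A.ncard ∧
    ∀ B, IsArcFragment R B → 2 ≤ B.ncard → A.ncard ≤ B.ncard

/-- A positive `λ`-superatom. -/
def IsPosLambdaSuperatom {V : Type*} (R : V → V → Prop) (A : Set V) : Prop :=
  IsPosFragment R A ∧ 2 ≤ A.ncard ∧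
    ∀ B, IsArcFragment R B → 2 ≤ B.ncard → A.ncard ≤ B.ncard

/-- A negative `λ`-superatom. -/
def IsNegLambdaSuperatom {V : Type*} (R : V → V → Prop) (A : Set V) : Prop :=
  IsNegFragment R A ∧ 2 ≤ A.ncard ∧
    ∀ B, IsArcFragment R B → 2 ≤ B.ncard → A.ncard ≤ B.ncard

/-- The set of out-arcs of a vertex. -/
def outArcsOf {V : Type*} (R : V → V → Prop) (v : V) : Set (V × V) :=
  {p | R p.1 p.2 ∧ p.1 = v}

/-- The set of in-arcs of a vertex. -/
def inArcsOf {V : Type*} (R : V → V → Prop) (v : V) : Set (V × V) :=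
  {p | R p.1 p.2 ∧ p.2 = v}

/-- A digraph is super-`λ` if every minimum arc-disconnecting set is the set of
in-arcs of some vertex or the set of out-arcs of some vertex. -/
def SuperLambda {V : Type*} (R : V → V → Prop) : Prop :=
  ∀ W : Set (V × V), IsDisconnectingArcSet R W → W.ncard = arcConnectivity R →
    (∃ v, W = outArcsOf R v) ∨ (∃ v, W = inArcsOf R v)

/-- Deleting all arcs that leave a proper nonempty vertex set disconnects the digraph. -/
theorem isDisconnectingArcSet_omegaPlus {V : Type*} (R : V → V → Prop) {A : Set V}
    (hne : A.Nonempty) (huniv : A ≠ Set.univ) : IsDisconnectingArcSet R (omegaPlus R A) := by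
  refine ⟨fun p hp => hp.1, fun hconn => ?_⟩
  obtain ⟨a, ha⟩ := hne
  obtain ⟨b, hb⟩ := (Set.ne_univ_iff_exists_notMem A).1 huniv
  refine hb ?_
  clear hb
  induction hconn a b with
  | refl => exact ha
  | tail _ h ih =>
    by_contra hc
    exact h.2 ⟨h.1, ih, hc⟩

theorem arcConnectivity_le_ncard_omegaPlus {V : Type*} (R : V → V → Prop) {A : Set V}
    (hne : A.Nonempty) (huniv : A ≠ Set.univ) : arcConnectivity R ≤ (omegaPlus R A).ncard :=
  Nat.sInf_le ⟨_, isDisconnectingArcSet_omegaPlus R hne huniv, rfl⟩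

/-- The arcs leaving `t₁⁻¹H × {0} ∪ H × {1}` are among the arcs `(h, 1) → (s₁h, 1)`, `h ∈ H`. -/
theorem omegaPlus_MDArc_subset_image {G : Type*} [Group G] {S0 S1 T0 T1 : Set G}
    {H : Subgroup G} {s1 t1 : G}
    (hS1 : ∀ s ∈ S1, s ≠ s1 → s ∈ H) (hS0 : ∀ s ∈ S0, t1 * s * t1⁻¹ ∈ H)
    (hT0 : ∀ t ∈ T0, t * t1⁻¹ ∈ H) (hT1 : ∀ t ∈ T1, t1 * t⁻¹ ∈ H) :
    omegaPlus (MDArc S0 S1 T0 T1) {v | bif v.2 then v.1 ∈ H else t1 * v.1 ∈ H} ⊆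
      (fun h : G => ((h, true), (s1 * h, true))) '' (H : Set G) := by
  rintro ⟨⟨g, i⟩, ⟨k, j⟩⟩ ⟨harc, hin, hout⟩
  simp only [MDArc] at harc
  obtain ⟨rfl, rfl, s, hs, rfl⟩ | ⟨rfl, rfl, s, hs, rfl⟩ | ⟨rfl, rfl, t, ht, rfl⟩ |
    ⟨rfl, rfl, t, ht, rfl⟩ := harc <;>
    simp only [Set.mem_ofPred_eq, cond_true, cond_false] at hin hout
  · exact absurd (by simpa [mul_assoc] using H.mul_mem (hS0 s hs) hin) hout
  · obtain rfl | hne := eq_or_ne s s1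
    · exact ⟨g, hin, rfl⟩
    · exact absurd (H.mul_mem (hS1 s hs hne) hin) hout
  · exact absurd (by simpa [mul_assoc] using H.mul_mem (hT0 t ht) hin) hout
  · exact absurd (by simpa [mul_assoc] using H.mul_mem (hT1 t ht) hin) hout

/-- Condition 3 implies `λ(X) < δ(X)`. -/
theorem mixedCayley_condition3_not_maxLambda
    {G : Type*} [Group G] [Fintype G] (S0 S1 T0 T1 : Set G)
    (hS0 : (1 : G) ∉ S0) (hS1 : (1 : G) ∉ S1)
    (hT0 : T0.Nonempty) (hT1 : T1.Nonempty)
    (hsc : DigraphStronglyConnected (MDArc S0 S1 T0 T1))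
    (H : Subgroup G) (hH : H ≠ ⊤)
    (hcard : Nat.card H < minDegree (MDArc S0 S1 T0 T1))
    (s1 : G) (hs1 : s1 ∈ S1)
    (hgen : Subgroup.closure ((S1 ∪ {1}) \ {s1}) ≤ H)
    (t1 : G) (ht1 : t1 ∈ T1)
    (hS0H : (Subgroup.closure S0 : Set G) ⊆ {t1}⁻¹ * (H : Set G) * {t1})
    (hT0H : T0 * {t1}⁻¹ ⊆ (H : Set G))
    (hT1H : {t1} * T1⁻¹ ⊆ (H : Set G)) :
    arcConnectivity (MDArc S0 S1 T0 T1) < minDegree (MDArc S0 S1 T0 T1) := by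
  have hS1' : ∀ s ∈ S1, s ≠ s1 → s ∈ H := fun s hs hne =>
    hgen (Subgroup.subset_closure ⟨Or.inl hs, hne⟩)
  have hS0' : ∀ s ∈ S0, t1 * s * t1⁻¹ ∈ H := by
    intro s hs
    obtain ⟨_, ⟨a, ha, h, hh, rfl⟩, b, hb, rfl⟩ := hS0H (Subgroup.subset_closure hs)
    obtain rfl : a = t1⁻¹ := by simpa using ha
    obtain rfl : b = t1 := hb
    simpa [mul_assoc] using hh
  have hT0' : ∀ t ∈ T0, t * t1⁻¹ ∈ H := fun t ht =>
    hT0H (Set.mul_mem_mul ht (by simp))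
  have hT1' : ∀ t ∈ T1, t1 * t⁻¹ ∈ H := fun t ht =>
    hT1H (Set.mul_mem_mul rfl (Set.inv_mem_inv.2 ht))
  have huniv : {v : G × Bool | bif v.2 then v.1 ∈ H else t1 * v.1 ∈ H} ≠ Set.univ := fun h =>
    hH ((Subgroup.eq_top_iff' H).2 fun x => (h ▸ Set.mem_univ (x, true) :
      (x, true) ∈ {v : G × Bool | bif v.2 then v.1 ∈ H else t1 * v.1 ∈ H}))
  calc arcConnectivity (MDArc S0 S1 T0 T1)
      ≤ _ := arcConnectivity_le_ncard_omegaPlus _ ⟨(1, true), H.one_mem⟩ huniv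
    _ ≤ _ := Set.ncard_le_ncard (omegaPlus_MDArc_subset_image hS1' hS0' hT0' hT1')
      ((Set.toFinite _).image _)
    _ ≤ (H : Set G).ncard := Set.ncard_image_le (Set.toFinite _)
    _ = Nat.card H := rfl
    _ < _ := hcard
end

section
/- Let X = MD(G, S0, S1, T0, T1) be a strongly connected mixed Cayley digraph that is max-λ but not super-λ, neither a directed cycle nor a cycle, and not in the class F. Let A be a λ-superatom of X. (1) If A ⊆ X_i for some i ∈ {0,1}, write A = H × {i} with H ⊆ G; then if (1_G, i) ∈ A, the set H is a subgroup of G. (2) If A ∩ X_0 ≠ ∅ and A ∩ X_1 ≠ ∅, write A ∩ X_i = H_i × {i}; then if (1_G, i) ∈ A, the set H_i is a subgroup of G. -/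
open Set Pointwise

/-- The digraph is a directed cycle. -/
def IsDirectedCycleDigraph {V : Type*} (R : V → V → Prop) : Prop :=
  DigraphStronglyConnected R ∧ ∀ v, outDegree R v = 1 ∧ inDegree R v = 1

/-- The digraph is a cycle: the digraph obtained from an undirected cycle by
replacing each edge with two oppositely oriented arcs. -/
def IsBidirectedCycleDigraph {V : Type*} (R : V → V → Prop) : Prop :=
  DigraphStronglyConnected R ∧ (∀ u v, R u v → R v u) ∧
    ∀ v, outDegree R v = 2 ∧ inDegree R v = 2

/-- The arc relation of the Cayley digraph `Cay(G,S)`. -/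
def CayRel {G : Type*} [Group G] (S : Set G) (g h : G) : Prop :=
  ∃ s ∈ S, h = s * g

/-- A digraph is a disjoint union of directed cycles iff every vertex has
out-degree and in-degree one. -/
def IsUnionOfDirectedCycles {V : Type*} (R : V → V → Prop) : Prop :=
  ∀ v, outDegree R v = 1 ∧ inDegree R v = 1

/-- A digraph is a disjoint union of directed cycles of length two iff every
vertex has out-degree and in-degree one and the arc relation is symmetric. -/
def IsUnionOfTwoCycles {V : Type*} (R : V → V → Prop) : Prop :=
  IsUnionOfDirectedCycles R ∧ ∀ u v, R u v → R v u

/-- The arc relation of the bipartite part `BD(G,T0,T1)` of the mixed Cayley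
digraph: the arcs between `X_0` and `X_1`. -/
def BDArc {G : Type*} [Group G] (T0 T1 : Set G) (u v : G × Bool) : Prop :=
  (u.2 = false ∧ v.2 = true ∧ ∃ t ∈ T0, v.1 = t * u.1) ∨
  (u.2 = true ∧ v.2 = false ∧ ∃ t ∈ T1, u.1 = t * v.1)

/-- The class `F`: one of `Cay(G×{0},S0)`, `Cay(G×{1},S1)` is a disjoint union
of directed cycles, the other is a disjoint union of directed cycles of length
two, and the bipartite part `BD(G,T0,T1)` is a disjoint union of directed
cycles of length two. -/
def InClassF {G : Type*} [Group G] (S0 S1 T0 T1 : Set G) : Prop :=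
  ((IsUnionOfDirectedCycles (CayRel S0) ∧ IsUnionOfTwoCycles (CayRel S1)) ∨
   (IsUnionOfDirectedCycles (CayRel S1) ∧ IsUnionOfTwoCycles (CayRel S0))) ∧
  IsUnionOfTwoCycles (BDArc T0 T1)

/-- The number of arcs from `C` to `D`, for a `0/1`-valued adjacency function `r`. -/
def arcCount {V : Type*} (r : V → V → ℕ) (C D : Finset V) : ℕ :=
  ∑ x ∈ C, ∑ y ∈ D, r x y

section ArcCount

variable {V : Type*} (r : V → V → ℕ)

theorem arcCount_mono {C C' D D' : Finset V} (hC : C ⊆ C') (hD : D ⊆ D') :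
    arcCount r C D ≤ arcCount r C' D' :=
  (Finset.sum_le_sum fun _ _ => Finset.sum_le_sum_of_subset hD).trans
    (Finset.sum_le_sum_of_subset hC)

theorem arcCount_singleton_left (v : V) (D : Finset V) :
    arcCount r {v} D = ∑ y ∈ D, r v y := by
  simp [arcCount]

theorem arcCount_singleton_right (C : Finset V) (v : V) :
    arcCount r C {v} = ∑ x ∈ C, r x v := by
  simp [arcCount]

theorem arcCount_flip (C D : Finset V) :
    arcCount (fun x y => r y x) C D = arcCount r D C :=
  Finset.sum_comm

variable [DecidableEq V]

theorem arcCount_union_left {C C' : Finset V} (h : Disjoint C C') (D : Finset V) :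
    arcCount r (C ∪ C') D = arcCount r C D + arcCount r C' D :=
  Finset.sum_union h

theorem arcCount_union_right (C : Finset V) {D D' : Finset V} (h : Disjoint D D') :
    arcCount r C (D ∪ D') = arcCount r C D + arcCount r C D' := by
  simp [arcCount, Finset.sum_union h, Finset.sum_add_distrib]

variable [Fintype V]

theorem arcCount_eq_sum_univ (C D : Finset V) :
    arcCount r C D = ∑ x, ∑ y, if x ∈ C ∧ y ∈ D then r x y else 0 := by
  rw [arcCount, ← Finset.sum_filter_add_sum_filter_not Finset.univ (· ∈ C)]
  simp +contextual [ite_and]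

theorem arcCount_submodular (A B : Finset V) :
    arcCount r (A ∩ B) (A ∩ B)ᶜ + arcCount r (A ∪ B) (A ∪ B)ᶜ ≤
      arcCount r A Aᶜ + arcCount r B Bᶜ := by
  simp only [arcCount_eq_sum_univ, ← Finset.sum_add_distrib]
  refine Finset.sum_le_sum fun x _ => Finset.sum_le_sum fun y _ => ?_
  by_cases h1 : x ∈ A <;> by_cases h2 : x ∈ B <;> by_cases h3 : y ∈ A <;>
    by_cases h4 : y ∈ B <;> simp [h1, h2, h3, h4]

theorem arcCount_erase {A : Finset V} {v : V} (hv : v ∈ A) :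
    arcCount r (A.erase v) (A.erase v)ᶜ + arcCount r {v} Aᶜ =
      arcCount r A Aᶜ + arcCount r (A.erase v) {v} := by
  have h1 : (A.erase v)ᶜ = Aᶜ ∪ {v} := by
    ext x; by_cases h : x = v <;> simp [h]
  have h2 : Disjoint Aᶜ {v} := by simpa using hv
  have h3 : A.erase v ∪ {v} = A := by
    ext x; by_cases h : x = v <;> simp [h, hv]
  have h4 : Disjoint (A.erase v) {v} := by simp
  have h5 := arcCount_union_left r h4 Aᶜ
  rw [h3] at h5
  rw [h1, arcCount_union_right r _ h2, h5]
  ring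

theorem sum_le_sum_compl_add_sum_compl {A B : Finset V} {v : V} (h : A ∩ B = {v}) {f : V → ℕ}
    (hf : f v = 0) : ∑ y, f y ≤ ∑ y ∈ Aᶜ, f y + ∑ y ∈ Bᶜ, f y := by
  simp only [← Finset.sum_filter_add_sum_filter_not Finset.univ (· ∈ Aᶜ) f]
  have e1 : Finset.univ.filter (· ∈ Aᶜ) = Aᶜ := by ext; simp
  rw [e1]
  refine Nat.add_le_add_left ?_ _
  refine Finset.sum_le_sum_of_ne_zero fun x hx hx0 => ?_
  simp only [Finset.mem_filter, Finset.mem_univ, true_and, Finset.mem_compl, not_not] at hx ⊢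
  intro hB
  have : x ∈ A ∩ B := Finset.mem_inter.2 ⟨hx, hB⟩
  rw [h, Finset.mem_singleton] at this
  exact hx0 (this ▸ hf)

omit [Fintype V] in
theorem disjoint_erase_of_inter_eq_singleton {A B : Finset V} {v : V} (h : A ∩ B = {v}) :
    Disjoint (A.erase v) (B.erase v) := by
  rw [Finset.disjoint_left]
  intro x hx hx'
  simp only [Finset.mem_erase] at hx hx'
  have : x ∈ A ∩ B := Finset.mem_inter.2 ⟨hx.2, hx'.2⟩
  rw [h, Finset.mem_singleton] at this
  exact hx.1 this

end ArcCount

section Translation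

variable {G : Type*} [Group G]

/-- Right translation by `h` on `G × Bool`. -/
def rightTranslation (h : G) : G × Bool ≃ G × Bool :=
  (Equiv.mulRight h).prodCongr (Equiv.refl Bool)

@[simp]
theorem rightTranslation_apply (h : G) (x : G × Bool) :
    rightTranslation h x = (x.1 * h, x.2) := rfl

/-- The right rightTranslate of a finite set of vertices. -/
def rightTranslate (A : Finset (G × Bool)) (h : G) : Finset (G × Bool) :=
  A.map (rightTranslation h).toEmbedding

theorem mem_rightTranslate {A : Finset (G × Bool)} {h : G} {x : G × Bool} :
    x ∈ rightTranslate A h ↔ (x.1 * h⁻¹, x.2) ∈ A := by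
  rw [rightTranslate, Finset.mem_map_equiv]
  rfl

@[simp]
theorem card_rightTranslate (A : Finset (G × Bool)) (h : G) : (rightTranslate A h).card = A.card :=
  Finset.card_map _

theorem card_filter_rightTranslate (A : Finset (G × Bool)) (h : G) (j : Bool) :
    ((rightTranslate A h).filter (·.2 = j)).card = (A.filter (·.2 = j)).card := by
  rw [rightTranslate, Finset.filter_map, Finset.card_map]
  rfl

end Translation

/-- A right-invariant, irreflexive `0/1`-valued adjacency function on `G × Bool`
with arcs in both directions between the two sides. -/
structure IsMixedAdjacency {G : Type*} [Group G] (r : G × Bool → G × Bool → ℕ) : Prop where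
  le_one : ∀ x y, r x y ≤ 1
  irrefl : ∀ x, r x x = 0
  invariant : ∀ x y h, r (rightTranslation h x) (rightTranslation h y) = r x y
  exists_cross : ∀ i, ∃ x y, r (x, i) (y, !i) = 1

namespace IsMixedAdjacency

variable {G : Type*} [Group G] {r : G × Bool → G × Bool → ℕ}

theorem swap (hr : IsMixedAdjacency r) : IsMixedAdjacency (fun x y => r y x) where
  le_one x y := hr.le_one y x
  irrefl := hr.irrefl
  invariant x y h := hr.invariant y x h
  exists_cross i := by
    obtain ⟨x, y, h⟩ := hr.exists_cross (!i)
    exact ⟨y, x, by simpa using h⟩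

theorem arcCount_rightTranslate (hr : IsMixedAdjacency r) (C D : Finset (G × Bool)) (h : G) :
    arcCount r (rightTranslate C h) (rightTranslate D h) = arcCount r C D := by
  simp only [arcCount, rightTranslate, Finset.sum_map]
  exact Finset.sum_congr rfl fun x _ => Finset.sum_congr rfl fun y _ => hr.invariant x y h

variable [Fintype G]

theorem rightTranslate_compl [DecidableEq G] (C : Finset (G × Bool)) (h : G) :
    (rightTranslate C h)ᶜ = rightTranslate Cᶜ h := by
  ext x; simp [mem_rightTranslate]

/-- The number of arcs from a vertex on side `i` to side `j`. -/
def sideDegree (r : G × Bool → G × Bool → ℕ) (i j : Bool) : ℕ :=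
  ∑ y : G, r (1, i) (y, j)

theorem sum_out (hr : IsMixedAdjacency r) (g : G) (i j : Bool) :
    ∑ y : G, r (g, i) (y, j) = sideDegree r i j := by
  rw [sideDegree, ← Equiv.sum_comp (Equiv.mulRight g)]
  refine Finset.sum_congr rfl fun y _ => ?_
  simpa using hr.invariant (1, i) (y, j) g

theorem sum_in (hr : IsMixedAdjacency r) (g : G) (i j : Bool) :
    ∑ x : G, r (x, i) (g, j) = sideDegree r i j := by
  rw [sideDegree, ← Equiv.sum_comp ((Equiv.inv G).trans (Equiv.mulRight g))]
  refine Finset.sum_congr rfl fun y _ => ?_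
  simpa using (hr.invariant (y⁻¹ * g, i) (g, j) (g⁻¹ * y)).symm

theorem sideDegree_cross_pos (hr : IsMixedAdjacency r) (i : Bool) :
    0 < sideDegree r i (!i) := by
  obtain ⟨x, y, h⟩ := hr.exists_cross i
  rw [← hr.sum_out x]
  have := Finset.single_le_sum (f := fun y : G => r (x, i) (y, !i))
    (fun _ _ => Nat.zero_le _) (Finset.mem_univ y)
  simp only [h] at this
  omega

omit [Group G] in
theorem sum_univ_eq (f : G × Bool → ℕ) (i : Bool) :
    ∑ x, f x = ∑ g, f (g, i) + ∑ g, f (g, !i) := by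
  rw [Fintype.sum_prod_type_right]
  cases i <;> simp [add_comm]

omit [Group G] in
theorem sum_filter_side (f : G × Bool → ℕ) (i : Bool) :
    ∑ x ∈ Finset.univ.filter (fun x : G × Bool => x.2 = i), f x = ∑ g, f (g, i) := by
  rw [Finset.sum_filter, sum_univ_eq _ i]
  simp

theorem sum_out_univ (hr : IsMixedAdjacency r) (v : G × Bool) :
    ∑ y, r v y = sideDegree r v.2 v.2 + sideDegree r v.2 (!v.2) := by
  rw [sum_univ_eq _ v.2, ← hr.sum_out v.1, ← hr.sum_out v.1]

theorem sum_in_univ (hr : IsMixedAdjacency r) (v : G × Bool) :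
    ∑ x, r x v = sideDegree r v.2 v.2 + sideDegree r (!v.2) v.2 := by
  rw [sum_univ_eq _ v.2, ← hr.sum_in v.1, ← hr.sum_in v.1]

end IsMixedAdjacency

/-- A set `A` with exactly `L` leaving arcs, containing between two and half of the vertices, where
`L` is a lower bound for the number of arcs leaving a proper nonempty set, and where every smaller
set with at least two vertices has more than `L` leaving and more than `L` entering arcs. -/
structure IsOutSuperatom {V : Type*} [Fintype V] [DecidableEq V] (r : V → V → ℕ) (L : ℕ)
    (A : Finset V) : Prop where
  le_out : ∀ C : Finset V, C.Nonempty → C ≠ Finset.univ → L ≤ arcCount r C Cᶜ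
  two_le_card : 2 ≤ A.card
  two_mul_card_le : 2 * A.card ≤ Fintype.card V
  out_eq : arcCount r A Aᶜ = L
  lt_out : ∀ C : Finset V, 2 ≤ C.card → C.card < A.card → L < arcCount r C Cᶜ
  lt_in : ∀ C : Finset V, 2 ≤ C.card → C.card < A.card → L < arcCount r Cᶜ C

namespace IsOutSuperatom

section General

variable {V : Type*} [Fintype V] [DecidableEq V] {r : V → V → ℕ} {L : ℕ} {A B : Finset V}

theorem le_sum_out (hA : IsOutSuperatom r L A) (v : V) : L ≤ ∑ y, r v y := by
  have h1 := hA.two_le_card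
  have h2 := hA.two_mul_card_le
  have h := hA.le_out {v} (Finset.singleton_nonempty v) (by
    intro h
    have := congrArg Finset.card h
    rw [Finset.card_singleton, Finset.card_univ] at this
    omega)
  exact h.trans ((arcCount_mono r subset_rfl (Finset.subset_univ _)).trans
    (arcCount_singleton_left r v _).le)

theorem le_sum_in (hA : IsOutSuperatom r L A) (v : V) : L ≤ ∑ x, r x v := by
  have h1 := hA.two_le_card
  have h2 := hA.two_mul_card_le
  have hc : ({v} : Finset V)ᶜ.card = Fintype.card V - 1 := by
    rw [Finset.card_compl, Finset.card_singleton]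
  have h := hA.le_out {v}ᶜ (Finset.card_pos.1 (by omega)) (by
    intro h
    have := congrArg Finset.card h
    rw [hc, Finset.card_univ] at this
    omega)
  rw [compl_compl] at h
  exact h.trans ((arcCount_mono r (Finset.subset_univ _) subset_rfl).trans
    (arcCount_singleton_right r _ v).le)

theorem eq_or_inter_eq_singleton (hA : IsOutSuperatom r L A) (hB : IsOutSuperatom r L B)
    (hcard : B.card = A.card) {v : V} (hvA : v ∈ A) (hvB : v ∈ B) :
    B = A ∨ A ∩ B = {v} := by
  by_contra! hcon
  obtain ⟨hne, hs⟩ := hcon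
  have hv : v ∈ A ∩ B := Finset.mem_inter.2 ⟨hvA, hvB⟩
  have h2 : 2 ≤ (A ∩ B).card := by
    by_contra hlt
    apply hs
    have h1 : (A ∩ B).card = 1 := by
      have := Finset.card_pos.2 ⟨v, hv⟩
      omega
    obtain ⟨w, hw⟩ := Finset.card_eq_one.1 h1
    rw [hw, Finset.mem_singleton] at hv
    rw [hw, hv]
  have h3 : (A ∩ B).card < A.card := by
    refine Finset.card_lt_card (Finset.ssubset_iff_subset_ne.2 ⟨Finset.inter_subset_left, ?_⟩)
    intro h
    exact hne (Finset.eq_of_subset_of_card_le (Finset.inter_eq_left.1 h) hcard.le).symm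
  have h4 := hA.lt_out _ h2 h3
  have h5 : L ≤ arcCount r (A ∪ B) (A ∪ B)ᶜ := by
    refine hA.le_out _ ⟨v, Finset.mem_union_left _ hvA⟩ fun h => ?_
    have h6 := Finset.card_union_add_card_inter A B
    rw [h, Finset.card_univ] at h6
    have := hA.two_mul_card_le
    omega
  have h6 := arcCount_submodular r A B
  rw [hA.out_eq, hB.out_eq] at h6
  omega

theorem card_erase_pos (hA : IsOutSuperatom r L A) (v : V) : 0 < (A.erase v).card := by
  have h1 := Finset.pred_card_le_card_erase (s := A) (a := v)
  have h2 := hA.two_le_card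
  omega

theorem arcCount_singleton_le (hA : IsOutSuperatom r L A) {v : V} (hv : v ∈ A) :
    arcCount r {v} Aᶜ ≤ arcCount r (A.erase v) {v} := by
  have h1 := arcCount_erase r hv
  have h2 := hA.le_out (A.erase v) (Finset.card_pos.1 (hA.card_erase_pos v)) (by
    intro h
    have := Finset.mem_univ v
    rw [← h] at this
    simp at this)
  rw [hA.out_eq] at h1
  omega

theorem arcCount_singleton_lt (hA : IsOutSuperatom r L A) (h3 : 3 ≤ A.card) {v : V} (hv : v ∈ A) :
    arcCount r {v} Aᶜ < arcCount r (A.erase v) {v} := by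
  have h1 := arcCount_erase r hv
  have hc := Finset.card_erase_of_mem hv
  have h2 := hA.lt_out (A.erase v) (by omega) (by omega)
  rw [hA.out_eq] at h1
  omega

end General

variable {G : Type*} [Group G] [Fintype G] [DecidableEq G] {r : G × Bool → G × Bool → ℕ} {L : ℕ}
  {A B : Finset (G × Bool)}

open IsMixedAdjacency

theorem translate_right (hr : IsMixedAdjacency r) (hA : IsOutSuperatom r L A) (h : G) :
    IsOutSuperatom r L (rightTranslate A h) where
  le_out := hA.le_out
  two_le_card := by simpa using hA.two_le_card
  two_mul_card_le := by simpa using hA.two_mul_card_le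
  out_eq := by rw [rightTranslate_compl, hr.arcCount_rightTranslate, hA.out_eq]
  lt_out := by simpa using hA.lt_out
  lt_in := by simpa using hA.lt_in

theorem sum_out_le (hr : IsMixedAdjacency r) {v : G × Bool} (h : A ∩ B = {v}) :
    sideDegree r v.2 v.2 + sideDegree r v.2 (!v.2) ≤ arcCount r {v} Aᶜ + arcCount r {v} Bᶜ := by
  rw [← hr.sum_out_univ, arcCount_singleton_left, arcCount_singleton_left]
  exact sum_le_sum_compl_add_sum_compl h (hr.irrefl v)

theorem arcCount_erase_add_le (hr : IsMixedAdjacency r) {v : G × Bool} (h : A ∩ B = {v}) :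
    arcCount r (A.erase v) {v} + arcCount r (B.erase v) {v} ≤
      sideDegree r v.2 v.2 + sideDegree r (!v.2) v.2 := by
  rw [← hr.sum_in_univ, ← arcCount_union_left r (disjoint_erase_of_inter_eq_singleton h),
    arcCount_singleton_right]
  exact Finset.sum_le_sum_of_subset (Finset.subset_univ _)

theorem arcCount_erase_add_le_card (hr : IsMixedAdjacency r) {v : G × Bool} (h : A ∩ B = {v}) :
    arcCount r (A.erase v) {v} + arcCount r (B.erase v) {v} ≤
      sideDegree r v.2 v.2 +
        ((A.filter (·.2 = !v.2)).card + (B.filter (·.2 = !v.2)).card) := by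
  rw [← arcCount_union_left r (disjoint_erase_of_inter_eq_singleton h), arcCount_singleton_right,
    ← Finset.sum_filter_add_sum_filter_not _ (fun x : G × Bool => x.2 = v.2)]
  refine add_le_add ?_ ?_
  · rw [← hr.sum_in v.1 v.2 v.2, ← sum_filter_side (fun x => r x v)]
    exact Finset.sum_le_sum_of_subset (Finset.filter_subset_filter _ (Finset.subset_univ _))
  · refine (Finset.sum_le_card_nsmul _ _ 1 fun x _ => hr.le_one x v).trans ?_
    rw [smul_eq_mul, mul_one]
    refine (Finset.card_le_card ?_).trans (Finset.card_union_le _ _)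
    intro x hx
    simp only [Finset.mem_filter, Finset.mem_union, Finset.mem_erase] at hx ⊢
    have : x.2 = !v.2 := Bool.eq_not_of_ne hx.2
    tauto

theorem sideDegree_add_two_le (hr : IsMixedAdjacency r) (hA : IsOutSuperatom r L A)
    (hB : IsOutSuperatom r L B) (hA3 : 3 ≤ A.card) (hB3 : 3 ≤ B.card) {v : G × Bool}
    (h : A ∩ B = {v}) : sideDegree r v.2 (!v.2) + 2 ≤ sideDegree r (!v.2) v.2 := by
  have hv : v ∈ A ∩ B := by rw [h]; simp
  rw [Finset.mem_inter] at hv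
  have h1 := hA.arcCount_singleton_lt hA3 hv.1
  have h2 := hB.arcCount_singleton_lt hB3 hv.2
  have h3 := sum_out_le hr h
  have h4 := arcCount_erase_add_le hr h
  omega

theorem rightTranslate_eq_self (hr : IsMixedAdjacency r) (hA : IsOutSuperatom r L A)
    (hA3 : 3 ≤ A.card) {i : Bool} (hlt : sideDegree r i (!i) < sideDegree r (!i) i + 2)
    {w w' : G × Bool} (hw : w ∈ A) (hw' : w' ∈ A) (hwi : w.2 = !i) (hwi' : w'.2 = !i) :
    rightTranslate A (w.1⁻¹ * w'.1) = A := by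
  refine (hA.eq_or_inter_eq_singleton (hA.translate_right hr _) (card_rightTranslate _ _) hw'
    ?_).resolve_right fun h => ?_
  · rw [mem_rightTranslate]
    convert hw using 1
    ext <;> simp [hwi, hwi']
  · have := sideDegree_add_two_le hr hA (hA.translate_right hr _) hA3 (by simpa using hA3) h
    simp only [hwi', Bool.not_not] at this
    omega

theorem card_mul_add_le (hr : IsMixedAdjacency r) (hA : IsOutSuperatom r L A) {v : G × Bool}
    (hv : v ∈ A)
    (hinv : ∀ w ∈ A, ∀ w' ∈ A, w.2 = (!v.2) → w'.2 = (!v.2) →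
      rightTranslate A (w.1⁻¹ * w'.1) = A) :
    (A.filter (·.2 = !v.2)).card * arcCount r {v} Aᶜ + arcCount r (A.filter (·.2 = !v.2)) Aᶜ ≤
      L := by
  rw [← hA.out_eq]
  obtain h0 | ⟨w, hw⟩ := (A.filter (·.2 = !v.2)).eq_empty_or_nonempty
  · simp [h0, arcCount]
  set S := A.filter (·.2 = !v.2) with hS
  have hw' := Finset.mem_filter.1 hw
  let f : G × Bool → G × Bool := fun w' => rightTranslation (w.1⁻¹ * w'.1) v
  have hfA : ∀ w' ∈ S, f w' ∈ A := by
    intro w' h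
    have h' := Finset.mem_filter.1 h
    rw [← hinv w hw'.1 w' h'.1 hw'.2 h'.2, mem_rightTranslate]
    simpa [f, mul_assoc] using hv
  have hfinj : Set.InjOn f S := by
    intro x hx y hy hxy
    have hx' := (Finset.mem_filter.1 hx).2
    have hy' := (Finset.mem_filter.1 hy).2
    have : v.1 * (w.1⁻¹ * x.1) = v.1 * (w.1⁻¹ * y.1) := congrArg Prod.fst hxy
    exact Prod.ext (mul_left_cancel (mul_left_cancel this)) (hx'.trans hy'.symm)
  have hdisj : Disjoint (S.image f) S := by
    rw [Finset.disjoint_left]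
    intro x hx hx'
    obtain ⟨w', -, rfl⟩ := Finset.mem_image.1 hx
    have := (Finset.mem_filter.1 hx').2
    simp [f] at this
  have hO : arcCount r (S.image f) Aᶜ = S.card * arcCount r {v} Aᶜ := by
    rw [arcCount, Finset.sum_image hfinj, Finset.sum_const_nat]
    intro w' h
    have h' := Finset.mem_filter.1 h
    rw [← arcCount_singleton_left, ← hr.arcCount_rightTranslate {v} Aᶜ (w.1⁻¹ * w'.1),
      ← rightTranslate_compl, hinv w hw'.1 w' h'.1 hw'.2 h'.2]
    rfl
  rw [← hO, ← arcCount_union_left r hdisj]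
  refine arcCount_mono r (Finset.union_subset ?_ (Finset.filter_subset _ _)) subset_rfl
  exact Finset.image_subset_iff.2 hfA

theorem card_opposite_eq_two (hr : IsMixedAdjacency r) (hA : IsOutSuperatom r L A)
    {v : G × Bool} (h : A ∩ B = {v})
    (hcard : (B.filter (·.2 = !v.2)).card = (A.filter (·.2 = !v.2)).card)
    (hA' : (A.filter (·.2 = !v.2)).card * arcCount r {v} Aᶜ +
      arcCount r (A.filter (·.2 = !v.2)) Aᶜ ≤ L)
    (hB' : (B.filter (·.2 = !v.2)).card * arcCount r {v} Bᶜ +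
      arcCount r (B.filter (·.2 = !v.2)) Bᶜ ≤ L)
    (hb : sideDegree r v.2 (!v.2) + 2 ≤ 2 * (A.filter (·.2 = !v.2)).card) :
    (A.filter (·.2 = !v.2)).card = 2 ∧ L = sideDegree r v.2 v.2 + sideDegree r v.2 (!v.2) ∧
      L = 2 * arcCount r {v} Aᶜ ∧ arcCount r (A.filter (·.2 = !v.2)) Aᶜ = 0 := by
  have hpos := hr.sideDegree_cross_pos v.2
  have hL := hA.le_sum_out v
  rw [hr.sum_out_univ] at hL
  have hpq := sum_out_le hr h
  rw [hcard] at hB'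
  generalize (A.filter (·.2 = !v.2)).card = b at *
  have hb2 : 2 ≤ b := by omega
  have hb3 : b < 3 := by
    by_contra! h3
    have h4 := Nat.mul_le_mul_right (arcCount r {v} Aᶜ) h3
    have h5 := Nat.mul_le_mul_right (arcCount r {v} Bᶜ) h3
    omega
  obtain rfl : b = 2 := by omega
  omega

/-- The number of arcs leaving a set `S` contained in one side, counted inside that side, equals
the number of arcs entering it, because Cayley digraphs are regular. -/
theorem arcCount_compl_eq (hr : IsMixedAdjacency r) {S : Finset (G × Bool)} {j : Bool}
    (hS : ∀ x ∈ S, x.2 = j) :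
    arcCount r Sᶜ S ≤ S.card * sideDegree r (!j) j + arcCount r S (Sᶜ.filter (·.2 = j)) := by
  have h1 : arcCount r S S + arcCount r Sᶜ S =
      S.card * (sideDegree r j j + sideDegree r (!j) j) := by
    rw [← arcCount_union_left r disjoint_compl_right, Finset.union_compl, ← arcCount_flip,
      arcCount, Finset.sum_const_nat]
    intro x hx
    rw [hr.sum_in_univ, hS x hx]
  have h2 : arcCount r S S + arcCount r S (Sᶜ.filter (·.2 = j)) = S.card * sideDegree r j j := by
    have hd : Disjoint S (Sᶜ.filter (·.2 = j)) :=
      disjoint_compl_right.mono_right (Finset.filter_subset _ _)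
    have hu : S ∪ Sᶜ.filter (·.2 = j) = Finset.univ.filter (·.2 = j) := by
      ext x
      have := hS x
      by_cases hx : x ∈ S <;> simp_all
    rw [← arcCount_union_right r _ hd, hu, arcCount, Finset.sum_const_nat]
    intro x hx
    rw [sum_filter_side, ← hr.sum_out x.1, ← hS x hx]
  rw [mul_add] at h1
  omega

theorem inter_rightTranslate_ne_singleton (hr : IsMixedAdjacency r) (hA : IsOutSuperatom r L A)
    {v w : G × Bool} (hwA : w ∈ A) (hwv : w ≠ v) (hw2 : w.2 = v.2) (g : G) :
    A ∩ rightTranslate A g ≠ {v} := by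
  intro h
  have hB := hA.translate_right hr g
  have hbc := card_filter_rightTranslate A g (!v.2)
  have hBcard := card_rightTranslate A g
  generalize rightTranslate A g = B at *
  have hv : v ∈ A ∩ B := by rw [h]; simp
  rw [Finset.mem_inter] at hv
  have hpos := hr.sideDegree_cross_pos v.2
  have hpq := sum_out_le hr h
  have hin := arcCount_erase_add_le_card hr h
  rw [hbc] at hin
  have hpA := hA.arcCount_singleton_le hv.1
  have hpB := hB.arcCount_singleton_le hv.2
  obtain ⟨u, hu⟩ : (A.filter (·.2 = !v.2)).Nonempty := by
    rw [← Finset.card_pos]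
    omega
  have hu' := Finset.mem_filter.1 hu
  have hA3 : 3 ≤ A.card := by
    have hsub : ({u, v, w} : Finset (G × Bool)) ⊆ A := by
      simp [Finset.insert_subset_iff, hu'.1, hv.1, hwA]
    have huv : u ≠ v := by rintro rfl; simp at hu'
    have huw : u ≠ w := by rintro rfl; simp [hw2] at hu'
    have := Finset.card_le_card hsub
    rwa [Finset.card_eq_three.2 ⟨u, v, w, huv, huw, hwv.symm, rfl⟩] at this
  have hB3 : 3 ≤ B.card := by omega
  have hpA := hA.arcCount_singleton_lt hA3 hv.1
  have hpB := hB.arcCount_singleton_lt hB3 hv.2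
  have hgap := sideDegree_add_two_le hr hA hB hA3 hB3 h
  have hlt : sideDegree r v.2 (!v.2) < sideDegree r (!v.2) v.2 + 2 := by omega
  have hA' := card_mul_add_le hr hA hv.1 fun x hx y hy hxi hyi =>
    rightTranslate_eq_self hr hA hA3 hlt hx hy hxi hyi
  have hB' := card_mul_add_le hr hB hv.2 fun x hx y hy hxi hyi =>
    rightTranslate_eq_self hr hB hB3 hlt hx hy hxi hyi
  obtain ⟨hb, hLeq, hLp, h0⟩ := card_opposite_eq_two hr hA h hbc hA' hB' (by omega)
  set S := A.filter (·.2 = !v.2) with hS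
  have hSc : ∀ x ∈ S, x.2 = !v.2 := fun x hx => (Finset.mem_filter.1 hx).2
  have hzero : ∀ x ∈ S, ∀ y ∉ A, r x y = 0 := by
    intro x hx y hy
    have := Finset.sum_eq_zero_iff.1 h0 x hx
    exact Finset.sum_eq_zero_iff.1 this y (by simpa using hy)
  have hjj : sideDegree r (!v.2) (!v.2) ≤ 1 := by
    have hc : (S.erase u).card = 1 := by rw [Finset.card_erase_of_mem hu, hb]
    rw [← hr.sum_out u.1, ← sum_filter_side (fun y => r (u.1, !v.2) y), ← hu'.2, ← hc,
      ← mul_one (S.erase u).card, ← smul_eq_mul]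
    refine (Finset.sum_le_sum_of_ne_zero fun y hy hy0 => ?_).trans
      (Finset.sum_le_card_nsmul _ _ 1 fun y _ => hr.le_one u y)
    rw [Finset.mem_erase, hS, Finset.mem_filter]
    refine ⟨fun h => hy0 (h ▸ hr.irrefl u), ?_, (Finset.mem_filter.1 hy).2.trans hu'.2⟩
    by_contra hyA
    exact hy0 (hzero u hu y hyA)
  have hii : sideDegree r v.2 v.2 ≤ 1 := by
    have := hA.le_sum_in u
    rw [hr.sum_in_univ, hu'.2, Bool.not_not] at this
    omega
  have ha : sideDegree r (!v.2) v.2 ≤ (A.filter (·.2 = v.2)).card := by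
    rw [← hr.sum_out u.1, ← sum_filter_side (fun y => r (u.1, !v.2) y), ← hu'.2,
      ← mul_one (A.filter (·.2 = v.2)).card, ← smul_eq_mul]
    refine (Finset.sum_le_sum_of_ne_zero fun y hy hy0 => ?_).trans
      (Finset.sum_le_card_nsmul _ _ 1 fun y _ => hr.le_one u y)
    rw [Finset.mem_filter]
    refine ⟨?_, (Finset.mem_filter.1 hy).2⟩
    by_contra hyA
    exact hy0 (hzero u hu y hyA)
  have hcount : (A.filter (·.2 = v.2)).card * sideDegree r v.2 (!v.2) ≤
      2 * sideDegree r v.2 (!v.2) + L := by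
    have h1 : arcCount r (A.filter (·.2 = v.2)) (Finset.univ.filter (·.2 = !v.2)) =
        (A.filter (·.2 = v.2)).card * sideDegree r v.2 (!v.2) := by
      rw [arcCount, Finset.sum_const_nat]
      intro x hx
      rw [sum_filter_side, ← hr.sum_out x.1, ← (Finset.mem_filter.1 hx).2]
    have h2 : arcCount r (Finset.univ.filter (·.2 = v.2)) S = 2 * sideDegree r v.2 (!v.2) := by
      rw [← hb, ← arcCount_flip, arcCount, Finset.sum_const_nat]
      intro x hx
      rw [sum_filter_side (fun y => r y x), ← hr.sum_in x.1, ← hSc x hx]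
    rw [← h1, ← h2, ← hA.out_eq]
    have h3 : (Finset.univ.filter (·.2 = !v.2) : Finset (G × Bool)) ⊆ S ∪ Aᶜ := by
      intro x hx
      by_cases hxA : x ∈ A <;> simp_all
    have h4 : Disjoint S Aᶜ := disjoint_compl_right.mono_left (Finset.filter_subset _ _)
    refine (arcCount_mono r subset_rfl h3).trans ?_
    rw [arcCount_union_right r _ h4]
    exact add_le_add
      (arcCount_mono r (Finset.filter_subset_filter _ (Finset.subset_univ _)) subset_rfl)
      (arcCount_mono r (Finset.filter_subset _ _) subset_rfl)
  have hone : sideDegree r v.2 (!v.2) = 1 := by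
    have h2 : sideDegree r v.2 (!v.2) ≤ 2 := by omega
    obtain h | h : sideDegree r v.2 (!v.2) = 1 ∨ sideDegree r v.2 (!v.2) = 2 := by omega
    · exact h
    · rw [h] at hcount
      omega
  have hlast := hA.lt_in S hb.ge (by omega)
  have hle := arcCount_compl_eq hr hSc
  have hz : arcCount r S (Sᶜ.filter (·.2 = !v.2)) = 0 := by
    refine Finset.sum_eq_zero fun x hx => Finset.sum_eq_zero fun y hy => hzero x hx y fun hyA => ?_
    simp only [Finset.mem_filter, Finset.mem_compl, hS] at hy
    exact hy.1 ⟨hyA, hy.2⟩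
  rw [Bool.not_not, hone, hb, hz] at hle
  omega

theorem rightTranslate_inv_eq (hr : IsMixedAdjacency r) (hA : IsOutSuperatom r L A) {i : Bool}
    {g : G} (h1 : ((1 : G), i) ∈ A) (hg : (g, i) ∈ A) : rightTranslate A g⁻¹ = A := by
  obtain rfl | hne := eq_or_ne g 1
  · ext x
    simp [mem_rightTranslate]
  refine (hA.eq_or_inter_eq_singleton (hA.translate_right hr _) (card_rightTranslate _ _) h1
    (by simpa [mem_rightTranslate] using hg)).resolve_right
    (inter_rightTranslate_ne_singleton (v := (1, i)) hr hA hg ?_ rfl _)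
  simpa using hne

theorem exists_subgroup (hr : IsMixedAdjacency r) (hA : IsOutSuperatom r L A) {i : Bool}
    (h1 : ((1 : G), i) ∈ A) : ∃ H : Subgroup G, (H : Set G) = {g : G | (g, i) ∈ A} := by
  have hinv : ∀ g, (g, i) ∈ A → ∀ x, (x * g, i) ∈ A ↔ (x, i) ∈ A := by
    intro g hg x
    conv_rhs => rw [← hA.rightTranslate_inv_eq hr h1 hg, mem_rightTranslate]
    simp
  refine ⟨{ carrier := {g : G | (g, i) ∈ A}, one_mem' := h1, mul_mem' := ?_, inv_mem' := ?_ }, rfl⟩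
  · intro a b ha hb
    exact (hinv b hb a).2 ha
  · intro a ha
    exact (hinv a ha a⁻¹).1 (by simpa using h1)

end IsOutSuperatom

section Relation

open Classical in
/-- The `0/1`-valued adjacency function of a relation. -/
noncomputable def adjacencyFun {V : Type*} (R : V → V → Prop) (x y : V) : ℕ :=
  if R x y then 1 else 0

variable {V : Type*} {R : V → V → Prop}

theorem arcConnectivity_le_ncard {W : Set (V × V)} (hW : IsDisconnectingArcSet R W) :
    arcConnectivity R ≤ W.ncard :=
  Nat.sInf_le ⟨W, hW, rfl⟩

theorem isDisconnectingArcSet_omegaPlus_s17 {C : Set V} (hne : C.Nonempty) (hu : C ≠ Set.univ) :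
    IsDisconnectingArcSet R (omegaPlus R C) := by
  refine ⟨fun p hp => hp.1, fun hsc => ?_⟩
  obtain ⟨u, hu'⟩ := hne
  obtain ⟨v, hv⟩ := (Set.ne_univ_iff_exists_notMem C).1 hu
  refine hv (Relation.ReflTransGen.head_induction_on (motive := fun a _ => a ∈ C → v ∈ C)
    (hsc u v) id (fun {a b} h _ ih ha => ih ?_) hu')
  by_contra hb
  exact h.2 ⟨h.1, ha, hb⟩

theorem omegaPlus_compl (C : Set V) : omegaPlus R Cᶜ = omegaMinus R C := by
  ext p; simp [omegaPlus, omegaMinus]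

theorem isNegFragment_compl {C : Set V} (hC : IsPosFragment R C) : IsNegFragment R Cᶜ := by
  refine ⟨Set.nonempty_compl.2 hC.2.1, fun h => ?_, ?_⟩
  · rw [Set.compl_univ_iff] at h
    exact hC.1.ne_empty h
  · rw [← omegaPlus_compl, compl_compl, hC.2.2]

variable [Finite V]

/-- In a finite digraph that is not super-`λ`, some positive fragment and its complement both have
at least two vertices. -/
theorem exists_isPosFragment_of_not_superLambda (hirr : ∀ v, ¬ R v v) (h : ¬ SuperLambda R) :
    ∃ C, IsPosFragment R C ∧ 2 ≤ C.ncard ∧ 2 ≤ Cᶜ.ncard := by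
  simp only [SuperLambda, not_forall, not_or, not_exists] at h
  obtain ⟨W, hW, hWc, hout, hin⟩ := h
  obtain ⟨u, v, huv⟩ : ∃ u v, ¬ Relation.ReflTransGen (fun u v => R u v ∧ (u, v) ∉ W) u v := by
    simpa [DigraphStronglyConnected] using hW.2
  set C : Set V := {x | Relation.ReflTransGen (fun u v => R u v ∧ (u, v) ∉ W) u x} with hC
  have hne : C.Nonempty := ⟨u, Relation.ReflTransGen.refl⟩
  have hu : C ≠ Set.univ := fun h => huv (h ▸ Set.mem_univ v : v ∈ C)
  have hsub : omegaPlus R C ⊆ W := by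
    rintro ⟨x, y⟩ ⟨hR, hx, hy⟩
    by_contra hxy
    exact hy (Relation.ReflTransGen.tail hx ⟨hR, hxy⟩)
  have heq : omegaPlus R C = W := by
    refine Set.eq_of_subset_of_ncard_le hsub ?_ (Set.toFinite _)
    rw [hWc]
    exact arcConnectivity_le_ncard (isDisconnectingArcSet_omegaPlus_s17 hne hu)
  have hnec : Cᶜ.Nonempty := Set.nonempty_compl.2 hu
  refine ⟨C, ⟨hne, hu, by rw [heq, hWc]⟩, ?_, ?_⟩
  · have hpos := (Set.ncard_pos (Set.toFinite C)).2 hne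
    by_contra hlt
    obtain ⟨c, hc⟩ := Set.ncard_eq_one.1 (show C.ncard = 1 by omega)
    apply hout c
    rw [← heq, hc]
    ext ⟨x, y⟩
    simp only [omegaPlus, outArcsOf, Set.mem_ofPred_eq, Set.mem_singleton_iff]
    constructor
    · exact fun h => ⟨h.1, h.2.1⟩
    · rintro ⟨hR, rfl⟩
      exact ⟨hR, rfl, by rintro rfl; exact hirr _ hR⟩
  · have hpos := (Set.ncard_pos (Set.toFinite Cᶜ)).2 hnec
    by_contra hlt
    obtain ⟨c, hc⟩ := Set.ncard_eq_one.1 (show Cᶜ.ncard = 1 by omega)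
    have hmem : ∀ x, x ∉ C ↔ x = c := fun x => by
      rw [← Set.mem_compl_iff, hc, Set.mem_singleton_iff]
    apply hin c
    rw [← heq]
    ext ⟨x, y⟩
    simp only [omegaPlus, inArcsOf, Set.mem_ofPred_eq, hmem]
    constructor
    · exact fun h => ⟨h.1, h.2.2⟩
    · rintro ⟨hR, rfl⟩
      refine ⟨hR, ?_, rfl⟩
      by_contra hx
      rw [hmem] at hx
      exact hirr _ (hx ▸ hR)

end Relation

section FiniteRelation

variable {V : Type*} [Fintype V] [DecidableEq V] {R : V → V → Prop}

theorem ncard_omegaPlus (C : Finset V) :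
    (omegaPlus R (C : Set V)).ncard = arcCount (adjacencyFun R) C Cᶜ := by
  classical
  have h : omegaPlus R (C : Set V) = ((C ×ˢ Cᶜ).filter fun p => R p.1 p.2 : Finset (V × V)) := by
    ext p
    simp [omegaPlus, and_comm]
  rw [h, Set.ncard_coe_finset, Finset.card_filter, Finset.sum_product]
  rfl

theorem ncard_omegaMinus (C : Finset V) :
    (omegaMinus R (C : Set V)).ncard = arcCount (adjacencyFun R) Cᶜ C := by
  rw [← omegaPlus_compl, ← Finset.coe_compl, ncard_omegaPlus, compl_compl]

theorem arcConnectivity_le_arcCount {C : Finset V} (hne : C.Nonempty) (hu : C ≠ Finset.univ) :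
    arcConnectivity R ≤ arcCount (adjacencyFun R) C Cᶜ := by
  rw [← ncard_omegaPlus]
  exact arcConnectivity_le_ncard (isDisconnectingArcSet_omegaPlus_s17 (by simpa using hne)
    (by simpa using hu))

omit [DecidableEq V] in
theorem IsLambdaSuperatom.two_mul_card_le {A : Finset V} (hA : IsLambdaSuperatom R (A : Set V))
    (hirr : ∀ v, ¬ R v v) (h : ¬ SuperLambda R) : 2 * A.card ≤ Fintype.card V := by
  obtain ⟨C, hC, h2, h2'⟩ := exists_isPosFragment_of_not_superLambda hirr h
  have h3 := hA.2.2 C (Or.inl hC) h2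
  have h4 := hA.2.2 Cᶜ (Or.inr (isNegFragment_compl hC)) h2'
  have h5 := Set.ncard_add_ncard_compl C
  rw [Nat.card_eq_fintype_card] at h5
  rw [Set.ncard_coe_finset] at h3 h4
  omega

theorem IsLambdaSuperatom.lt_arcCount {A : Finset V} (hA : IsLambdaSuperatom R (A : Set V))
    (hA2 : 2 * A.card ≤ Fintype.card V) {C : Finset V} (h2 : 2 ≤ C.card) (hlt : C.card < A.card) :
    arcConnectivity R < arcCount (adjacencyFun R) C Cᶜ ∧
      arcConnectivity R < arcCount (adjacencyFun R) Cᶜ C := by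
  have hne : C.Nonempty := Finset.card_pos.1 (by omega)
  have hu : C ≠ Finset.univ := by
    rintro rfl
    rw [Finset.card_univ] at hlt
    omega
  have hne' : Cᶜ.Nonempty := Finset.nonempty_iff_ne_empty.2 (by simpa using hu)
  have hu' : Cᶜ ≠ Finset.univ := by simpa using hne.ne_empty
  have hfrag : ¬ IsArcFragment R (C : Set V) := fun h => by
    have := hA.2.2 C h (by rwa [Set.ncard_coe_finset])
    rw [Set.ncard_coe_finset, Set.ncard_coe_finset] at this
    omega
  have hle' := arcConnectivity_le_arcCount (R := R) hne' hu'
  rw [compl_compl] at hle'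
  refine ⟨(arcConnectivity_le_arcCount hne hu).lt_of_ne fun h => hfrag (Or.inl ?_),
    hle'.lt_of_ne fun h => hfrag (Or.inr ?_)⟩
  · exact ⟨by simpa using hne, by simpa using hu, by rw [ncard_omegaPlus, h]⟩
  · exact ⟨by simpa using hne, by simpa using hu, by rw [ncard_omegaMinus, h]⟩

theorem IsLambdaSuperatom.isOutSuperatom {A : Finset V} (hA : IsLambdaSuperatom R (A : Set V))
    (hirr : ∀ v, ¬ R v v) (h : ¬ SuperLambda R) :
    IsOutSuperatom (adjacencyFun R) (arcConnectivity R) A ∨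
      IsOutSuperatom (fun x y => adjacencyFun R y x) (arcConnectivity R) A := by
  have h2 : 2 ≤ A.card := by simpa [Set.ncard_coe_finset] using hA.2.1
  have hhalf := hA.two_mul_card_le hirr h
  refine hA.1.imp (fun hp => ?_) fun hn => ?_
  · exact {
      le_out := fun C => arcConnectivity_le_arcCount
      two_le_card := h2
      two_mul_card_le := hhalf
      out_eq := by rw [← ncard_omegaPlus, hp.2.2]
      lt_out := fun C h1 h2 => (hA.lt_arcCount hhalf h1 h2).1
      lt_in := fun C h1 h2 => (hA.lt_arcCount hhalf h1 h2).2 }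
  · refine {
      le_out := fun C hne hu => ?_
      two_le_card := h2
      two_mul_card_le := hhalf
      out_eq := by rw [arcCount_flip, ← ncard_omegaMinus, hn.2.2]
      lt_out := fun C h1 h2 => by
        rw [arcCount_flip]
        exact (hA.lt_arcCount hhalf h1 h2).2
      lt_in := fun C h1 h2 => by
        rw [arcCount_flip]
        exact (hA.lt_arcCount hhalf h1 h2).1 }
    have := arcConnectivity_le_arcCount (R := R) (C := Cᶜ)
      (Finset.nonempty_iff_ne_empty.2 (by simpa using hu)) (by simpa using hne.ne_empty)
    rwa [arcCount_flip, ← compl_compl C, compl_compl Cᶜ]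

end FiniteRelation

section MixedCayley

variable {G : Type*} [Group G] {S0 S1 T0 T1 : Set G}

theorem not_MDArc_self (hS0 : (1 : G) ∉ S0) (hS1 : (1 : G) ∉ S1) (v : G × Bool) :
    ¬ MDArc S0 S1 T0 T1 v v := by
  rintro (⟨-, -, s, hs, h⟩ | ⟨-, -, s, hs, h⟩ | ⟨h, h', -⟩ | ⟨h, h', -⟩)
  · rw [right_eq_mul] at h
    exact hS0 (h ▸ hs)
  · rw [right_eq_mul] at h
    exact hS1 (h ▸ hs)
  · simp [h] at h'
  · simp [h] at h'

theorem MDArc_rightTranslation_iff (x y : G × Bool) (h : G) :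
    MDArc S0 S1 T0 T1 (rightTranslation h x) (rightTranslation h y) ↔ MDArc S0 S1 T0 T1 x y := by
  simp only [MDArc, rightTranslation_apply, ← mul_assoc, mul_left_inj]

theorem isMixedAdjacency_MDArc (hS0 : (1 : G) ∉ S0) (hS1 : (1 : G) ∉ S1) (hT0 : T0.Nonempty)
    (hT1 : T1.Nonempty) : IsMixedAdjacency (adjacencyFun (MDArc S0 S1 T0 T1)) where
  le_one x y := by unfold adjacencyFun; split_ifs <;> simp
  irrefl x := if_neg (not_MDArc_self hS0 hS1 x)
  invariant x y h := by
    unfold adjacencyFun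
    congr 1
    exact propext (MDArc_rightTranslation_iff x y h)
  exists_cross i := by
    obtain ⟨t, ht⟩ := hT0
    obtain ⟨t', ht'⟩ := hT1
    cases i
    · exact ⟨1, t, if_pos (by simp [MDArc, ht])⟩
    · exact ⟨t', 1, if_pos (by simp [MDArc, ht'])⟩

theorem exists_subgroup_of_isLambdaSuperatom [Fintype G] (hS0 : (1 : G) ∉ S0)
    (hS1 : (1 : G) ∉ S1) (hT0 : T0.Nonempty) (hT1 : T1.Nonempty)
    (hnsuper : ¬ SuperLambda (MDArc S0 S1 T0 T1)) {A : Set (G × Bool)}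
    (hA : IsLambdaSuperatom (MDArc S0 S1 T0 T1) A) {i : Bool} (h1 : ((1 : G), i) ∈ A) :
    ∃ H : Subgroup G, (H : Set G) = {g : G | (g, i) ∈ A} := by
  classical
  lift A to Finset (G × Bool) using Set.toFinite A
  have hr := isMixedAdjacency_MDArc hS0 hS1 hT0 hT1
  obtain h | h := hA.isOutSuperatom (not_MDArc_self hS0 hS1) hnsuper
  · exact h.exists_subgroup hr h1
  · exact h.exists_subgroup hr.swap h1

end MixedCayley

/-- subgroup structure of a λ-superatom. -/
theorem mixedCayley_superatom_subgroup
    {G : Type*} [Group G] [Fintype G] (S0 S1 T0 T1 : Set G)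
    (hS0 : (1 : G) ∉ S0) (hS1 : (1 : G) ∉ S1)
    (hT0 : T0.Nonempty) (hT1 : T1.Nonempty)
    (hsc : DigraphStronglyConnected (MDArc S0 S1 T0 T1))
    (hmax : arcConnectivity (MDArc S0 S1 T0 T1) = minDegree (MDArc S0 S1 T0 T1))
    (hnsuper : ¬ SuperLambda (MDArc S0 S1 T0 T1))
    (hndir : ¬ IsDirectedCycleDigraph (MDArc S0 S1 T0 T1))
    (hnbidir : ¬ IsBidirectedCycleDigraph (MDArc S0 S1 T0 T1))
    (hnF : ¬ InClassF S0 S1 T0 T1)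
    (A : Set (G × Bool)) (hA : IsLambdaSuperatom (MDArc S0 S1 T0 T1) A) :
    (∀ i : Bool, A ⊆ {p : G × Bool | p.2 = i} → ((1 : G), i) ∈ A →
      ∃ H : Subgroup G, (H : Set G) = {g : G | (g, i) ∈ A}) ∧
    ((A ∩ {p : G × Bool | p.2 = false}).Nonempty →
      (A ∩ {p : G × Bool | p.2 = true}).Nonempty →
      ∀ i : Bool, ((1 : G), i) ∈ A →
        ∃ H : Subgroup G, (H : Set G) = {g : G | (g, i) ∈ A}) := by
  exact ⟨fun i _ h1 => exists_subgroup_of_isLambdaSuperatom hS0 hS1 hT0 hT1 hnsuper hA h1,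
    fun _ _ i h1 => exists_subgroup_of_isLambdaSuperatom hS0 hS1 hT0 hT1 hnsuper hA h1⟩
end
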